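/- arXiv:2508.12568 — 2 statements merged into one kernel-verified Lean document; each statement's English description precedes it below -/
import Mathlib

section
/- Let X be a nonempty locally compact Hausdorff space and E a quasi-perfect vector lattice. Then every regular operator from C₀(X) into E is norm to order bounded, i.e., L_r(C₀(X), E) = L_nob(C₀(X), E). -/
open scoped ZeroAtInfty

namespace ZeroAtInftyContinuousMap

variable {X : Type*} [TopologicalSpace X]

/-- The pointwise maximum of two continuous real functions vanishing at infinity. -/
def pointwiseMax (f g : C₀(X, ℝ)) : C₀(X, ℝ) where
  toFun x := max (f x) (g x)
  continuous_toFun := (map_continuous f).max (map_continuous g)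
  zero_at_infty' := by
    simpa using (zero_at_infty f).max (zero_at_infty g)

@[simp]
theorem pointwiseMax_apply (f g : C₀(X, ℝ)) (x : X) : f.pointwiseMax g x = max (f x) (g x) :=
  rfl

theorem abs_apply_le_norm (f : C₀(X, ℝ)) (x : X) : |f x| ≤ ‖f‖ :=
  f.toBCF.norm_coe_le_norm x

theorem norm_le_of_forall_abs_le {f : C₀(X, ℝ)} {c : ℝ} (hc : 0 ≤ c) (h : ∀ x, |f x| ≤ c) :
    ‖f‖ ≤ c :=
  (BoundedContinuousFunction.norm_le (f := f.toBCF) hc).2 h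

/-- Evaluation at a point, as a continuous linear functional. -/
noncomputable def evalContinuousLinearMap (x : X) : C₀(X, ℝ) →L[ℝ] ℝ :=
  LinearMap.mkContinuous ⟨⟨fun f => f x, fun _ _ => rfl⟩, fun _ _ => rfl⟩ 1
    fun f => by simpa using f.abs_apply_le_norm x

/-- A positive linear functional is bounded on the positive part of the unit ball. -/
theorem exists_forall_le_of_positive (φ : C₀(X, ℝ) →ₗ[ℝ] ℝ)
    (hφ : ∀ f : C₀(X, ℝ), (∀ x, 0 ≤ f x) → 0 ≤ φ f) :
    ∃ M, ∀ f : C₀(X, ℝ), (∀ x, 0 ≤ f x) → ‖f‖ ≤ 1 → φ f ≤ M := by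
  by_contra! H
  choose f hf0 hf1 hf using fun n : ℕ => H (4 ^ n)
  have hsum : Summable fun n : ℕ => (1 / 2 : ℝ) ^ n • f n := by
    refine Summable.of_norm_bounded summable_geometric_two fun n => ?_
    rw [norm_smul, Real.norm_of_nonneg (by positivity)]
    exact mul_le_of_le_one_right (by positivity) (hf1 n)
  obtain ⟨F, hF⟩ := hsum
  have hle (n : ℕ) : (2 : ℝ) ^ n ≤ φ F := by
    have hpos : 0 ≤ φ (F - (1 / 2 : ℝ) ^ n • f n) := hφ _ fun x => by
      have hx : HasSum (fun n : ℕ => (1 / 2 : ℝ) ^ n * f n x) (F x) :=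
        (evalContinuousLinearMap x).hasSum hF
      exact sub_nonneg.2 (le_hasSum hx n fun m _ => mul_nonneg (by positivity) (hf0 m x))
    rw [map_sub, map_smul, smul_eq_mul, sub_nonneg] at hpos
    calc (2 : ℝ) ^ n = (1 / 2) ^ n * 4 ^ n := by rw [← mul_pow]; norm_num
      _ ≤ (1 / 2) ^ n * φ (f n) := by gcongr; exact (hf n).le
      _ ≤ φ F := hpos
  obtain ⟨n, hn⟩ := pow_unbounded_of_one_lt (φ F) (one_lt_two : (1 : ℝ) < 2)
  exact (hle n).not_gt hn

/-- A positive operator whose values on the positive part of the unit ball have a supremum is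
norm to order bounded. -/
theorem abs_apply_le_norm_smul {E : Type*} [Lattice E] [AddCommGroup E] [IsOrderedAddMonoid E]
    [Module ℝ E] (hsmul : ∀ (c : ℝ) (y : E), 0 ≤ c → 0 ≤ y → 0 ≤ c • y)
    {S : C₀(X, ℝ) →ₗ[ℝ] E} (hS : ∀ f : C₀(X, ℝ), (∀ x, 0 ≤ f x) → 0 ≤ S f) {s : E}
    (hs : ∀ f : C₀(X, ℝ), (∀ x, 0 ≤ f x) → ‖f‖ ≤ 1 → S f ≤ s) (f : C₀(X, ℝ)) :
    |S f| ≤ ‖f‖ • s := by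
  rcases eq_or_ne f 0 with rfl | hf
  · simp
  have hn : 0 < ‖f‖ := norm_pos_iff.2 hf
  set g := f.pointwiseMax (-f) with hg
  have hgx (x : X) : g x = |f x| := by simp [hg, abs]
  have hle : S (‖f‖⁻¹ • g) ≤ s := by
    refine hs _ (fun x => ?_) ?_
    · rw [smul_apply, hgx]
      positivity
    · have hgf : ‖g‖ ≤ ‖f‖ := norm_le_of_forall_abs_le hn.le fun x => by
        rw [hgx, abs_abs]
        exact f.abs_apply_le_norm x
      rw [norm_smul, norm_inv, norm_norm]
      exact inv_mul_le_one_of_le₀ hgf hn.le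
  have hSg : S g ≤ ‖f‖ • s := by
    have h := hsmul ‖f‖ _ hn.le (sub_nonneg.2 hle)
    rwa [smul_sub, sub_nonneg, map_smul, smul_inv_smul₀ hn.ne'] at h
  refine (sup_le ?_ ?_ : |S f| ≤ S g).trans hSg
  · rw [← sub_nonneg, ← map_sub]
    refine hS _ fun x => ?_
    rw [sub_apply, hgx]
    exact sub_nonneg.2 (le_abs_self _)
  · rw [← sub_nonneg, ← map_neg, ← map_sub]
    refine hS _ fun x => ?_
    rw [sub_apply, hgx, neg_apply]
    exact sub_nonneg.2 (neg_le_abs _)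

/-- A positive operator into a vector lattice satisfying the supremum condition of
quasi-perfectness is norm to order bounded. -/
theorem exists_abs_apply_le_norm_smul {E : Type*} [Lattice E] [AddCommGroup E]
    [IsOrderedAddMonoid E] [Module ℝ E]
    (hsmul : ∀ (c : ℝ) (y : E), 0 ≤ c → 0 ≤ y → 0 ≤ c • y)
    (hquasi : ∀ D : Set E, D.Nonempty → (∀ y ∈ D, 0 ≤ y) → DirectedOn (· ≤ ·) D →
      (∀ φ : E →ₗ[ℝ] ℝ, (∀ y : E, 0 ≤ y → 0 ≤ φ y) → BddAbove (φ '' D)) → ∃ s, IsLUB D s)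
    {S : C₀(X, ℝ) →ₗ[ℝ] E} (hS : ∀ f : C₀(X, ℝ), (∀ x, 0 ≤ f x) → 0 ≤ S f) :
    ∃ s : E, 0 ≤ s ∧ ∀ f : C₀(X, ℝ), |S f| ≤ ‖f‖ • s := by
  have hmono {f g : C₀(X, ℝ)} (h : ∀ x, f x ≤ g x) : S f ≤ S g := by
    rw [← sub_nonneg, ← map_sub]
    exact hS _ fun x => sub_nonneg.2 (h x)
  set B : Set C₀(X, ℝ) := {f | (∀ x, 0 ≤ f x) ∧ ‖f‖ ≤ 1}
  have h0 : (0 : C₀(X, ℝ)) ∈ B := ⟨fun _ => le_rfl, by simp⟩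
  obtain ⟨s, hs⟩ := hquasi (S '' B) ⟨_, Set.mem_image_of_mem S h0⟩
    (by
      rintro _ ⟨f, hf, rfl⟩
      exact hS f hf.1)
    (by
      rintro _ ⟨f, hf, rfl⟩ _ ⟨g, hg, rfl⟩
      refine ⟨S (f.pointwiseMax g), ⟨_, ⟨fun x => le_max_of_le_left (hf.1 x), ?_⟩, rfl⟩,
        hmono fun x => le_max_left _ _, hmono fun x => le_max_right _ _⟩
      refine norm_le_of_forall_abs_le zero_le_one fun x => abs_max_le_max_abs_abs.trans ?_
      exact max_le ((f.abs_apply_le_norm x).trans hf.2) ((g.abs_apply_le_norm x).trans hg.2))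
    (by
      intro φ hφ
      obtain ⟨M, hM⟩ := exists_forall_le_of_positive (φ ∘ₗ S) fun f hf => hφ _ (hS f hf)
      refine ⟨M, ?_⟩
      rintro _ ⟨_, ⟨f, hf, rfl⟩, rfl⟩
      exact hM f hf.1 hf.2)
  refine ⟨s, by simpa using hs.1 (Set.mem_image_of_mem S h0), ?_⟩
  exact abs_apply_le_norm_smul hsmul hS fun f hf hf1 => hs.1 ⟨f, ⟨hf, hf1⟩, rfl⟩

end ZeroAtInftyContinuousMap

/-- Let `X` be a nonempty locally compact Hausdorff space and `E`
a quasi-perfect vector lattice (its order continuous order dual separates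
points, and every increasing net in `E⁺` on which every positive functional is
bounded has a supremum). Then every regular operator `T : C₀(X) → E`
(difference `T = T₁ - T₂` of positive operators) is norm to order bounded. -/
theorem stmt_9 {X : Type*} [TopologicalSpace X] [LocallyCompactSpace X]
    [T2Space X] [Nonempty X]
    {E : Type*} [Lattice E] [AddCommGroup E]
    [CovariantClass E E (· + ·) (· ≤ ·)] [Module ℝ E]
    -- `E` is normal: the positive order continuous functionals separate points
    (hnormal : ∀ x : E,
      (∀ φ : E →ₗ[ℝ] ℝ, (∀ y : E, 0 ≤ y → 0 ≤ φ y) →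
        (∀ A : Set E, A.Nonempty → DirectedOn (· ≥ ·) A → IsGLB A 0 →
          IsGLB (φ '' A) 0) →
        0 ≤ φ x) → 0 ≤ x)
    -- every upward directed set in `E⁺` on which each positive functional is
    -- bounded has a supremum in `E`
    (hquasi : ∀ D : Set E, D.Nonempty → (∀ y ∈ D, 0 ≤ y) →
      DirectedOn (· ≤ ·) D →
      (∀ φ : E →ₗ[ℝ] ℝ, (∀ y : E, 0 ≤ y → 0 ≤ φ y) → BddAbove (φ '' D)) →
      ∃ s, IsLUB D s)
    (T T₁ T₂ : C₀(X, ℝ) →ₗ[ℝ] E)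
    (h₁ : ∀ f : C₀(X, ℝ), (∀ x, 0 ≤ f x) → 0 ≤ T₁ f)
    (h₂ : ∀ f : C₀(X, ℝ), (∀ x, 0 ≤ f x) → 0 ≤ T₂ f)
    (hreg : T = T₁ - T₂) :
    ∃ t : E, 0 ≤ t ∧ ∀ f : C₀(X, ℝ), |T f| ≤ ‖f‖ • t := by
  have hadd (a b : E) (h : a ≤ b) (c : E) : c + a ≤ c + b := CovariantClass.elim c h
  have : IsOrderedAddMonoid E :=
    .mk (fun a b h c => by simpa only [add_comm _ c] using hadd a b h c) hadd
  have hsmul (c : ℝ) (y : E) (hc : 0 ≤ c) (hy : 0 ≤ y) : 0 ≤ c • y :=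
    hnormal _ fun φ hφ _ => by
      rw [map_smul]
      exact mul_nonneg hc (hφ y hy)
  obtain ⟨s₁, hs₁, hT₁⟩ :=
    ZeroAtInftyContinuousMap.exists_abs_apply_le_norm_smul hsmul hquasi h₁
  obtain ⟨s₂, hs₂, hT₂⟩ :=
    ZeroAtInftyContinuousMap.exists_abs_apply_le_norm_smul hsmul hquasi h₂
  refine ⟨s₁ + s₂, add_nonneg hs₁ hs₂, fun f => ?_⟩
  rw [hreg, LinearMap.sub_apply, sub_eq_add_neg, smul_add]
  refine (abs_add_le _ _).trans ?_
  rw [abs_neg]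
  exact add_le_add (hT₁ f) (hT₂ f)
end

section
/- Let (X, Ω) be a measurable space and E a Dedekind complete vector lattice. For two E̅⁺-valued measures μ, ν on Ω, the set map ξ defined by ξ(Δ) := sup{μ(Γ) + ν(Δ∖Γ) : Γ ∈ Ω, Γ ⊆ Δ} (supremum in E̅ = E ∪ {∞}) is σ-additive, i.e., is again an E̅⁺-valued measure, and it is the supremum of μ and ν in the pointwise order on such measures. -/
variable {X : Type*} [MeasurableSpace X]
variable {E : Type*} [Lattice E] [AddCommGroup E]
  [CovariantClass E E (· + ·) (· ≤ ·)]

/-- An `E̅⁺`-valued measure on the σ-algebra of `X`: a set map into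
`E̅ = WithTop E` which vanishes at `∅`, takes values `≥ 0` on measurable sets,
and is σ-additive, the countable sums being suprema of the finite partial
sums in `E̅`. -/
def IsEMeasure (μ : Set X → WithTop E) : Prop :=
  μ ∅ = 0 ∧ (∀ Δ, MeasurableSet Δ → 0 ≤ μ Δ) ∧
    ∀ Δ : ℕ → Set X, (∀ n, MeasurableSet (Δ n)) →
      Pairwise (Function.onFun Disjoint Δ) →
      IsLUB (Set.range fun N => ∑ n ∈ Finset.range N, μ (Δ n))
        (μ (⋃ n, Δ n))

/-- Addition in `WithTop E` is compatible with least upper bounds. -/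
theorem add_le_of_isLUB_of_forall_add_le {A B : Set (WithTop E)} {a b c : WithTop E}
    (hA : IsLUB A a) (hB : IsLUB B b) (hAne : A.Nonempty) (hBne : B.Nonempty)
    (h : ∀ x ∈ A, ∀ y ∈ B, x + y ≤ c) : a + b ≤ c := by
  have key : ∀ {S : Set (WithTop E)} {s y : WithTop E} {d : E}, IsLUB S s → S.Nonempty →
      (∀ x ∈ S, x + y ≤ (d : WithTop E)) → s + y ≤ (d : WithTop E) := by
    intro S s y d hS hSne hle
    obtain ⟨x₀, hx₀⟩ := hSne
    induction y with
    | top => simpa using hle x₀ hx₀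
    | coe y =>
      have hs : s ≤ ((d - y : E) : WithTop E) := hS.2 fun x hx => by
        have hxy := hle x hx
        induction x with
        | top => simp at hxy
        | coe x =>
          norm_cast at hxy ⊢
          exact le_sub_iff_add_le.mpr hxy
      induction s with
      | top => simp at hs
      | coe s =>
        norm_cast at hs ⊢
        exact le_sub_iff_add_le.mp hs
  induction c with
  | top => exact le_top
  | coe c =>
    refine key hA hAne fun x hx => ?_
    rw [add_comm]
    refine key hB hBne fun y hy => ?_
    rw [add_comm]
    exact h x hx y hy

namespace IsEMeasure

variable {μ ν : Set X → WithTop E}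

theorem union (hμ : IsEMeasure μ) {A B : Set X} (hA : MeasurableSet A) (hB : MeasurableSet B)
    (hAB : Disjoint A B) : μ (A ∪ B) = μ A + μ B := by
  let D : ℕ → Set X := fun n => if n = 0 then A else if n = 1 then B else ∅
  have hD : ∀ n, MeasurableSet (D n) := fun n => by
    dsimp only [D]
    split_ifs <;> simp [hA, hB]
  have hdisj : Pairwise (Function.onFun Disjoint D) := fun i j hij => by
    dsimp only [Function.onFun, D]
    split_ifs <;> first | omega | exact hAB | exact hAB.symm | simp
  have hU : ⋃ n, D n = A ∪ B := by
    ext x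
    simp only [Set.mem_iUnion, Set.mem_union]
    constructor
    · rintro ⟨n, hn⟩
      dsimp only [D] at hn
      split_ifs at hn <;> simp_all
    · rintro (h | h)
      · exact ⟨0, by simpa [D] using h⟩
      · exact ⟨1, by simpa [D] using h⟩
  have hsum : ∀ N, ∑ n ∈ Finset.range (N + 2), μ (D n) = μ A + μ B := by
    intro N
    induction N with
    | zero => simp [Finset.sum_range_succ, D]
    | succ N ih =>
      rw [show N + 1 + 2 = (N + 2) + 1 by omega, Finset.sum_range_succ, ih]
      simp [D, hμ.1]
  have hlub := hμ.2.2 D hD hdisj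
  rw [hU] at hlub
  refine le_antisymm (hlub.2 ?_) (hlub.1 ⟨2, hsum 0⟩)
  rintro _ ⟨N, rfl⟩
  dsimp only
  rw [← hsum N, Finset.sum_range_succ, Finset.sum_range_succ, add_assoc]
  exact le_add_of_nonneg_right (add_nonneg (hμ.2.1 _ (hD _)) (hμ.2.1 _ (hD _)))

theorem mono (hμ : IsEMeasure μ) {A B : Set X} (hA : MeasurableSet A) (hB : MeasurableSet B)
    (hAB : A ⊆ B) : μ A ≤ μ B := by
  rw [← Set.union_sdiff_cancel hAB, hμ.union hA (hB.diff hA) Set.disjoint_sdiff_right]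
  exact le_add_of_nonneg_right (hμ.2.1 _ (hB.diff hA))

theorem monotone_sum_range (hμ : IsEMeasure μ) {D : ℕ → Set X} (hD : ∀ n, MeasurableSet (D n)) :
    Monotone fun N => ∑ n ∈ Finset.range N, μ (D n) :=
  monotone_nat_of_le_succ fun N => by
    rw [Finset.sum_range_succ]
    exact le_add_of_nonneg_right (hμ.2.1 _ (hD N))

/-- If the partial sums of `μ (C n) + ν (D n)` are bounded by `c`, so is the sum of the measures
of the unions. -/
theorem add_iUnion_le (hμ : IsEMeasure μ) (hν : IsEMeasure ν) {C D : ℕ → Set X}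
    (hC : ∀ n, MeasurableSet (C n)) (hD : ∀ n, MeasurableSet (D n))
    (hCd : Pairwise (Function.onFun Disjoint C)) (hDd : Pairwise (Function.onFun Disjoint D))
    {c : WithTop E} (h : ∀ N, ∑ n ∈ Finset.range N, (μ (C n) + ν (D n)) ≤ c) :
    μ (⋃ n, C n) + ν (⋃ n, D n) ≤ c := by
  refine add_le_of_isLUB_of_forall_add_le (hμ.2.2 C hC hCd) (hν.2.2 D hD hDd)
    (Set.range_nonempty _) (Set.range_nonempty _) ?_
  rintro _ ⟨M, rfl⟩ _ ⟨N, rfl⟩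
  refine le_trans (add_le_add (hμ.monotone_sum_range hC (le_max_left M N))
    (hν.monotone_sum_range hD (le_max_right M N))) ?_
  dsimp only
  rw [← Finset.sum_add_distrib]
  exact h _

end IsEMeasure

/-- for `E̅⁺`-valued measures `μ, ν`, the set map
`ξ(Δ) = sup {μ(Γ) + ν(Δ∖Γ) : Γ measurable, Γ ⊆ Δ}` is again an `E̅⁺`-valued
measure, and it is the supremum of `μ` and `ν` in the pointwise order. -/
theorem stmt_10 (hDed : ∀ T : Set E, T.Nonempty → BddAbove T → ∃ a, IsLUB T a)
    (μ ν ξ : Set X → WithTop E) (hμ : IsEMeasure μ) (hν : IsEMeasure ν)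
    (hξ : ∀ Δ, MeasurableSet Δ →
      IsLUB {z : WithTop E | ∃ Γ, MeasurableSet Γ ∧ Γ ⊆ Δ ∧
        z = μ Γ + ν (Δ \ Γ)} (ξ Δ))
    :
    IsEMeasure ξ ∧
      (∀ Δ, MeasurableSet Δ → μ Δ ≤ ξ Δ ∧ ν Δ ≤ ξ Δ) ∧
      ∀ ρ : Set X → WithTop E, IsEMeasure ρ →
        (∀ Δ, MeasurableSet Δ → μ Δ ≤ ρ Δ) →
        (∀ Δ, MeasurableSet Δ → ν Δ ≤ ρ Δ) →
        ∀ Δ, MeasurableSet Δ → ξ Δ ≤ ρ Δ := by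
  have hle : ∀ {Δ Γ : Set X}, MeasurableSet Δ → MeasurableSet Γ → Γ ⊆ Δ →
      μ Γ + ν (Δ \ Γ) ≤ ξ Δ := fun hΔ hΓ h => (hξ _ hΔ).1 ⟨_, hΓ, h, rfl⟩
  have hμξ : ∀ Δ, MeasurableSet Δ → μ Δ ≤ ξ Δ := fun Δ hΔ => by
    simpa [hν.1] using hle hΔ hΔ subset_rfl
  have hνξ : ∀ Δ, MeasurableSet Δ → ν Δ ≤ ξ Δ := fun Δ hΔ => by
    simpa [hμ.1] using hle hΔ MeasurableSet.empty (Set.empty_subset Δ)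
  have hmono : ∀ {A B : Set X}, MeasurableSet A → MeasurableSet B → A ⊆ B → ξ A ≤ ξ B := by
    intro A B hA hB hAB
    refine (hξ A hA).2 ?_
    rintro _ ⟨Γ, hΓ, hΓA, rfl⟩
    refine le_trans ?_ (hle hB hΓ (hΓA.trans hAB))
    gcongr
    exact hν.mono (hA.diff hΓ) (hB.diff hΓ) (Set.sdiff_subset_sdiff_left hAB)
  have hsuper : ∀ {A B : Set X}, MeasurableSet A → MeasurableSet B → Disjoint A B →
      ξ A + ξ B ≤ ξ (A ∪ B) := by
    intro A B hA hB hAB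
    refine add_le_of_isLUB_of_forall_add_le (hξ A hA) (hξ B hB)
      ⟨_, ∅, MeasurableSet.empty, Set.empty_subset _, rfl⟩
      ⟨_, ∅, MeasurableSet.empty, Set.empty_subset _, rfl⟩ ?_
    rintro _ ⟨Γ, hΓ, hΓA, rfl⟩ _ ⟨Λ, hΛ, hΛB, rfl⟩
    have hdiff : (A ∪ B) \ (Γ ∪ Λ) = A \ Γ ∪ B \ Λ := by
      ext x
      have h₁ := @hΓA x
      have h₂ := @hΛB x
      have h₃ : x ∈ A → x ∉ B := fun h => Set.disjoint_left.mp hAB h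
      simp only [Set.mem_sdiff, Set.mem_union]
      tauto
    have h := hle (hA.union hB) (hΓ.union hΛ) (Set.union_subset_union hΓA hΛB)
    rw [hdiff, hμ.union hΓ hΛ (hAB.mono hΓA hΛB), hν.union (hA.diff hΓ) (hB.diff hΛ)
      (hAB.mono Set.sdiff_subset Set.sdiff_subset)] at h
    rwa [add_add_add_comm]
  have hempty : ξ ∅ = 0 := by
    refine le_antisymm ((hξ ∅ MeasurableSet.empty).2 ?_) (hμ.1 ▸ hμξ ∅ MeasurableSet.empty)
    rintro _ ⟨Γ, -, hΓ, rfl⟩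
    simp [Set.subset_empty_iff.mp hΓ, hμ.1, hν.1]
  refine ⟨⟨hempty, fun Δ hΔ => (hμ.2.1 Δ hΔ).trans (hμξ Δ hΔ), fun Δ hΔ hdisj => ⟨?_, ?_⟩⟩,
    fun Δ hΔ => ⟨hμξ Δ hΔ, hνξ Δ hΔ⟩, ?_⟩
  · have hsum : ∀ N, ∑ n ∈ Finset.range N, ξ (Δ n) ≤ ξ (⋃ n ∈ Finset.range N, Δ n) := by
      intro N
      induction N with
      | zero => simp [hempty]
      | succ N ih =>
        rw [Finset.sum_range_succ, Finset.range_add_one, Finset.set_biUnion_insert, Set.union_comm]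
        refine le_trans (add_le_add_left ih _) (hsuper
          (Finset.measurableSet_biUnion _ fun n _ => hΔ n) (hΔ N) ?_)
        simp only [Set.disjoint_iUnion_left, Finset.mem_range]
        exact fun n hn => hdisj hn.ne
    rintro _ ⟨N, rfl⟩
    exact (hsum N).trans (hmono (Finset.measurableSet_biUnion _ fun n _ => hΔ n)
      (MeasurableSet.iUnion hΔ) (Set.iUnion₂_subset fun n _ => Set.subset_iUnion Δ n))
  · intro c hc
    refine (hξ _ (MeasurableSet.iUnion hΔ)).2 ?_
    rintro _ ⟨Γ, hΓ, hΓΔ, rfl⟩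
    have hΓU : Γ = ⋃ n, Δ n ∩ Γ := by
      rw [← Set.iUnion_inter, Set.inter_eq_right.mpr hΓΔ]
    have hle_c := hμ.add_iUnion_le hν (c := c) (fun n => (hΔ n).inter hΓ)
      (fun n => (hΔ n).diff hΓ)
      (fun i j hij => (hdisj hij).mono Set.inter_subset_left Set.inter_subset_left)
      (fun i j hij => (hdisj hij).mono Set.sdiff_subset Set.sdiff_subset) fun N =>
        (Finset.sum_le_sum fun n _ => ?_).trans (hc ⟨N, rfl⟩)
    · rwa [← hΓU, ← Set.iUnion_sdiff] at hle_c
    · simpa using hle (hΔ n) ((hΔ n).inter hΓ) Set.inter_subset_left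
  · intro ρ hρ hμρ hνρ Δ hΔ
    refine (hξ Δ hΔ).2 ?_
    rintro _ ⟨Γ, hΓ, hΓΔ, rfl⟩
    calc μ Γ + ν (Δ \ Γ) ≤ ρ Γ + ρ (Δ \ Γ) := add_le_add (hμρ _ hΓ) (hνρ _ (hΔ.diff hΓ))
      _ = ρ Δ := by
        rw [← hρ.union hΓ (hΔ.diff hΓ) Set.disjoint_sdiff_right, Set.union_sdiff_cancel hΓΔ]
end
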